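/- The function T₂ satisfies the recursion T₂(n,m) = (μ₁/(μ₁+μ₂))·T₂(n-1,m+1) + (μ₂/(μ₁+μ₂))·T₂(n,m-1) for all n,m ≥ 1, together with the boundary conditions T₂(0,m) = m/μ₂ for all m ≥ 0 and T₂(n+1,0) = T₂(n,1) for all n ≥ 0. -/

import Mathlib

/-- `T₂` satisfies the recursion
`T₂(n,m) = (μ₁/(μ₁+μ₂))·T₂(n-1,m+1) + (μ₂/(μ₁+μ₂))·T₂(n,m-1)` for `n,m ≥ 1`,
with boundary conditions `T₂(0,m) = m/μ₂` and `T₂(n+1,0) = T₂(n,1)`. -/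
theorem stmt_1 (μ₁ μ₂ : ℝ) (hμ₁ : 0 < μ₁) (hμ₂ : 0 < μ₂)
    (T : ℕ × ℕ → ℝ)
    (hT0 : ∀ m : ℕ, T (0, m) = m / μ₂)
    (hTb : ∀ n : ℕ, T (n + 1, 0) = 1 / μ₁ + T (n, 1))
    (hTrec : ∀ n m : ℕ, T (n + 1, m + 1) =
      1 / (μ₁ + μ₂) + μ₁ / (μ₁ + μ₂) * T (n, m + 2) + μ₂ / (μ₁ + μ₂) * T (n + 1, m))
    (T₂ : ℕ → ℕ → ℝ)
    (hT₂ : ∀ n m : ℕ, T₂ n m = T (n, m) - n / μ₁) :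
    (∀ n m : ℕ, T₂ (n + 1) (m + 1) =
      μ₁ / (μ₁ + μ₂) * T₂ n (m + 2) + μ₂ / (μ₁ + μ₂) * T₂ (n + 1) m) ∧
    (∀ m : ℕ, T₂ 0 m = m / μ₂) ∧
    (∀ n : ℕ, T₂ (n + 1) 0 = T₂ n 1) := by
  have hs : μ₁ + μ₂ ≠ 0 := (add_pos hμ₁ hμ₂).ne'
  refine ⟨fun n m => ?_, fun m => ?_, fun n => ?_⟩
  · rw [hT₂, hT₂, hT₂, hTrec]
    push_cast
    field_simp
    ring
  · simp [hT₂, hT0]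
  · rw [hT₂, hT₂, hTb]
    push_cast
    ring
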